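/- Let O' be an integral domain, π, ϖ ∈ O' nonzero elements, q ≥ 2 and r ≥ 1 integers. Suppose (u_n)_{n ≥ 0} is a sequence of polynomials in O'[X_0, X_1, X_2, …] satisfying Φ^{(ϖ,q^r)}_m(u_0, …, u_m) = Φ^{(π,q)}_{rm}(X_0, …, X_{rm}) for all m ≥ 0. Then under the substitution X_i ↦ 0 for all i ≥ 1 (leaving X_0 fixed), u_0 becomes X_0 and u_m becomes 0 for every m ≥ 1. (Equivalently, the Drinfeld morphism is compatible with the Teichmüller sections: u ∘ τ = τ'.) -/

import Mathlib

open MvPolynomial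

/-- The `n`-th ramified Witt polynomial with respect to `(π, q)`,
evaluated at a sequence `b`: `Φ^{(π,q)}_n(b) = ∑_{i=0}^{n} π^i b_i^{q^{n-i}}`. -/
def wittPhi {R : Type*} [CommRing R] (π : R) (q : ℕ) (n : ℕ) (b : ℕ → R) : R :=
  ∑ i ∈ Finset.range (n + 1), π ^ i * b i ^ q ^ (n - i)

theorem map_wittPhi {R S F : Type*} [CommRing R] [CommRing S] [FunLike F R S]
    [RingHomClass F R S] (f : F) (π : R) (q n : ℕ) (b : ℕ → R) :
    f (wittPhi π q n b) = wittPhi (f π) q n (fun i => f (b i)) := by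
  simp [wittPhi]

/-- The Witt polynomials of a Teichmüller vector `(x, 0, 0, …)`. -/
theorem wittPhi_teichmuller {R : Type*} [CommRing R] (π : R) {q : ℕ} (hq : q ≠ 0) (n : ℕ) (x : R) :
    wittPhi π q n (fun i => if i = 0 then x else 0) = x ^ q ^ n := by
  rw [wittPhi, Finset.sum_eq_single 0]
  · simp
  · intro i _ hi
    simp [hi, hq]
  · simp

/-- Over a domain, a vector is determined by its Witt polynomials as soon as `π ≠ 0`. -/
theorem eq_of_forall_wittPhi_eq {R : Type*} [CommRing R] [IsDomain R] {π : R} (hπ : π ≠ 0) {q : ℕ}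
    {b c : ℕ → R} (h : ∀ n, wittPhi π q n b = wittPhi π q n c) (n : ℕ) : b n = c n := by
  induction n using Nat.strong_induction_on with
  | _ n ih =>
    have hn := h n
    rw [wittPhi, wittPhi, Finset.sum_range_succ, Finset.sum_range_succ,
      Finset.sum_congr rfl fun i hi => by rw [ih i (Finset.mem_range.mp hi)]] at hn
    simpa [hπ] using hn

theorem stmt_12 {O' : Type*} [CommRing O'] [IsDomain O'] (π ϖ : O')
    (hπ : π ≠ 0) (hϖ : ϖ ≠ 0) (q r : ℕ) (hq : 2 ≤ q) (hr : 1 ≤ r)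
    (u : ℕ → MvPolynomial ℕ O')
    (hu : ∀ m : ℕ, wittPhi (MvPolynomial.C ϖ) (q ^ r) m u
        = wittPhi (MvPolynomial.C π) q (r * m) (fun i => MvPolynomial.X i)) :
    MvPolynomial.aeval
        (fun i : ℕ => if i = 0 then (MvPolynomial.X 0 : MvPolynomial ℕ O') else 0) (u 0)
      = MvPolynomial.X 0 ∧
    ∀ m : ℕ, 1 ≤ m →
      MvPolynomial.aeval
          (fun i : ℕ => if i = 0 then (MvPolynomial.X 0 : MvPolynomial ℕ O') else 0) (u m)
        = 0 := by
  have hq0 : q ≠ 0 := by omega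
  set f := aeval (R := O') (fun i : ℕ => if i = 0 then (X 0 : MvPolynomial ℕ O') else 0) with hf
  have key : ∀ m, f (u m) = if m = 0 then X 0 else 0 := by
    refine eq_of_forall_wittPhi_eq (π := C ϖ) (q := q ^ r) (C_ne_zero.mpr hϖ) fun m => ?_
    have hfC (a : O') : f (C a) = C a := f.commutes a
    have h := congrArg f (hu m)
    rw [map_wittPhi, map_wittPhi, hfC, hfC] at h
    rw [h, wittPhi_teichmuller _ (pow_ne_zero r hq0)]
    simp only [hf, aeval_X]
    rw [wittPhi_teichmuller _ hq0, pow_mul]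
  exact ⟨by simpa using key 0, fun m hm => by simpa [Nat.one_le_iff_ne_zero.mp hm] using key m⟩
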